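/- Fix M ≥ 1, N_t ≥ 1, reals β_1,...,β_M > 0, δ_1,...,δ_M > 0, a power budget P > 0, and Hermitian positive semidefinite complex N_t×N_t matrices A_1,...,A_M. Let R★ be an N_t×N_t complex positive semidefinite matrix with Re(tr R★) ≤ P, define u_m = φ_m = (β_m · Re(tr(A_m R★)) + δ_m)⁻¹ for each m, and suppose that R★ maximizes Σ_{m=1}^M u_m φ_m β_m · Re(tr(A_m R)) over all N_t×N_t complex positive semidefinite matrices R with Re(tr R) ≤ P. Then R★ minimizes f(R) = Σ_{m=1}^M (β_m · Re(tr(A_m R)) + δ_m)⁻¹ over all such matrices, i.e., R★ is an optimal solution to Problem (P1). -/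

import Mathlib

open Matrix ComplexOrder

open scoped MatrixOrder in
theorem aux_trace_nonneg {n : ℕ} {A R : Matrix (Fin n) (Fin n) ℂ} (hA : A.PosSemidef)
    (hR : R.PosSemidef) : 0 ≤ (Matrix.trace (A * R)).re := by
  obtain ⟨B, rfl⟩ := CStarAlgebra.nonneg_iff_eq_star_mul_self.mp hA.nonneg
  have h := (hR.mul_mul_conjTranspose_same B).trace_nonneg
  rw [Matrix.star_eq_conjTranspose, Matrix.mul_assoc, Matrix.trace_mul_comm]
  exact (Complex.nonneg_iff.mp h).1

theorem aux_inv {x y : ℝ} (hx : 0 < x) (hy : 0 < y) :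
    x⁻¹ + x⁻¹ * x⁻¹ * (x - y) ≤ y⁻¹ := by
  have h : y⁻¹ - (x⁻¹ + x⁻¹ * x⁻¹ * (x - y)) = (x - y) ^ 2 * (x⁻¹ ^ 2 * y⁻¹) := by
    field_simp
    ring
  have : 0 ≤ (x - y) ^ 2 * (x⁻¹ ^ 2 * y⁻¹) := by positivity
  linarith

/-- sufficiency of the sum-of-ratios parametric reformulation: if `R★`
solves the parametric linear problem (P3-eqv') with parameters satisfying the fixed-point
conditions `u_m = φ_m = (β_m tr(A_m R★) + δ_m)⁻¹`, then `R★` is optimal for (P1). -/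
theorem stmt_14 {M Nt : ℕ} (hM : 1 ≤ M) (hNt : 1 ≤ Nt)
    (β δ : Fin M → ℝ) (hβ : ∀ m, 0 < β m) (hδ : ∀ m, 0 < δ m)
    {P : ℝ} (hP : 0 < P)
    (A : Fin M → Matrix (Fin Nt) (Fin Nt) ℂ) (hA : ∀ m, (A m).PosSemidef)
    (Rstar : Matrix (Fin Nt) (Fin Nt) ℂ) (hRstar : Rstar.PosSemidef)
    (htr : (Matrix.trace Rstar).re ≤ P)
    (u φ : Fin M → ℝ)
    (hu : ∀ m, u m = (β m * (Matrix.trace (A m * Rstar)).re + δ m)⁻¹)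
    (hφ : ∀ m, φ m = (β m * (Matrix.trace (A m * Rstar)).re + δ m)⁻¹)
    (hmax : ∀ R : Matrix (Fin Nt) (Fin Nt) ℂ, R.PosSemidef →
      (Matrix.trace R).re ≤ P →
      ∑ m, u m * φ m * β m * (Matrix.trace (A m * R)).re ≤
      ∑ m, u m * φ m * β m * (Matrix.trace (A m * Rstar)).re) :
    ∀ R : Matrix (Fin Nt) (Fin Nt) ℂ, R.PosSemidef → (Matrix.trace R).re ≤ P →
      ∑ m, (β m * (Matrix.trace (A m * Rstar)).re + δ m)⁻¹ ≤
      ∑ m, (β m * (Matrix.trace (A m * R)).re + δ m)⁻¹ := by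
  intro R hR hRP
  have h := hmax R hR hRP
  have key : ∑ m, ((β m * (Matrix.trace (A m * Rstar)).re + δ m)⁻¹ +
      (u m * φ m * β m * (Matrix.trace (A m * Rstar)).re -
        u m * φ m * β m * (Matrix.trace (A m * R)).re)) ≤
      ∑ m, (β m * (Matrix.trace (A m * R)).re + δ m)⁻¹ := by
    refine Finset.sum_le_sum fun m _ => ?_
    have h1 := mul_nonneg (hβ m).le (aux_trace_nonneg (hA m) hRstar)
    have h2 := mul_nonneg (hβ m).le (aux_trace_nonneg (hA m) hR)
    have h3 := aux_inv (add_pos_of_nonneg_of_pos h1 (hδ m)) (add_pos_of_nonneg_of_pos h2 (hδ m))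
    rw [hu, hφ]
    refine le_trans (le_of_eq ?_) h3
    ring
  rw [Finset.sum_add_distrib, Finset.sum_sub_distrib] at key
  linarith
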